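/- There exists a universal constant c > 0 such that, in the per-step LAZOb setup, the LAZOb gradient estimator satisfies E_u[‖g(u)‖²] ≤ D²η²d²L²/δ² + c·d·L². -/

import Mathlib

open MeasureTheory

/-- The uniform probability measure on the closed unit ball of `ℝ^d`. -/
noncomputable def ballUniform (d : ℕ) : Measure (EuclideanSpace ℝ (Fin d)) :=
  (volume (Metric.closedBall (0 : EuclideanSpace ℝ (Fin d)) 1))⁻¹ •
    volume.restrict (Metric.closedBall (0 : EuclideanSpace ℝ (Fin d)) 1)

/-- The uniform (rotation-invariant) probability measure on the unit sphere of `ℝ^d`,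
realized as the pushforward of the uniform measure on the unit ball under the radial
projection `v ↦ v / ‖v‖`. -/
noncomputable def sphereUniform (d : ℕ) : Measure (EuclideanSpace ℝ (Fin d)) :=
  Measure.map (fun v => ‖v‖⁻¹ • v) (ballUniform d)

section
open ProbabilityTheory Module
open scoped ENNReal RealInnerProductSpace

variable {E : Type*} [NormedAddCommGroup E] [InnerProductSpace ℝ E] [FiniteDimensional ℝ E]
  [MeasurableSpace E] [BorelSpace E]

/-- The standard Gaussian measure has density `(2π)^(-n/2) exp(-‖x‖²/2)`. -/
lemma stdGaussian_eq_withDensity :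
    stdGaussian E = volume.withDensity (fun x : E ↦ ENNReal.ofReal
      (((2 * Real.pi) ^ (finrank ℝ E / 2 : ℝ))⁻¹ * Real.exp (-(1 / 2) * ‖x‖ ^ 2))) := by
  have hb : 0 < ((1 / 2 : ℝ) : ℂ).re := by norm_num
  have hint : Integrable (fun x : E ↦ Real.exp (-(1 / 2) * ‖x‖ ^ 2)) := by
    have h := (GaussianFourier.integrable_cexp_neg_mul_sq_norm_add hb 0 (0 : E)).norm
    refine h.congr (.of_forall fun x ↦ ?_)
    simp only [zero_mul, add_zero, Complex.norm_exp]
    norm_cast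
  have hfin : IsFiniteMeasure (volume.withDensity (fun x : E ↦ ENNReal.ofReal
      (((2 * Real.pi) ^ (finrank ℝ E / 2 : ℝ))⁻¹ * Real.exp (-(1 / 2) * ‖x‖ ^ 2)))) :=
    isFiniteMeasure_withDensity_ofReal (hint.const_mul _).2
  refine Measure.ext_of_charFun ?_
  ext t
  rw [charFun_stdGaussian, charFun_apply,
    integral_withDensity_eq_integral_toReal_smul (by fun_prop) (by simp)]
  have h := GaussianFourier.integral_cexp_neg_mul_sq_norm_add hb Complex.I t
  have hpos : (0 : ℝ) < (2 * Real.pi) ^ (finrank ℝ E / 2 : ℝ) := by positivity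
  have hc : ((Real.pi : ℂ) / ((1 / 2 : ℝ) : ℂ)) ^ (finrank ℝ E / 2 : ℂ) =
      (((2 * Real.pi) ^ (finrank ℝ E / 2 : ℝ) : ℝ) : ℂ) := by
    rw [Complex.ofReal_cpow (by positivity)]
    push_cast
    congr 1
    field_simp
  rw [hc] at h
  have hcongr : ∀ x : E, (ENNReal.ofReal (((2 * Real.pi) ^ (finrank ℝ E / 2 : ℝ))⁻¹ *
      Real.exp (-(1 / 2) * ‖x‖ ^ 2))).toReal • Complex.exp (⟪x, t⟫ * Complex.I) =
      ((((2 * Real.pi) ^ (finrank ℝ E / 2 : ℝ))⁻¹ : ℝ) : ℂ) *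
        Complex.exp (-((1 / 2 : ℝ) : ℂ) * ‖x‖ ^ 2 + Complex.I * ⟪t, x⟫) := by
    intro x
    rw [ENNReal.toReal_ofReal (by positivity), Complex.exp_add, Complex.real_smul,
      real_inner_comm]
    push_cast
    ring_nf
  simp_rw [hcongr]
  rw [integral_const_mul, h, Complex.ofReal_inv, inv_mul_cancel_left₀]
  · congr 1
    push_cast
    rw [Complex.I_sq]
    ring
  · exact_mod_cast hpos.ne'

/-- Integration in polar coordinates of the product of a radial and an angular function. -/
lemma lintegral_radial_mul_angular [Nontrivial E] (μ : Measure E) [μ.IsAddHaarMeasure]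
    {ρ : ℝ → ℝ≥0∞} (hρ : Measurable ρ) {φ : E → ℝ≥0∞} (hφ : Measurable φ) :
    ∫⁻ x, ρ ‖x‖ * φ (‖x‖⁻¹ • x) ∂μ =
      (∫⁻ u, φ u.1 ∂μ.toSphere) * ∫⁻ r, ρ r.1 ∂Measure.volumeIoiPow (finrank ℝ E - 1) := by
  have h1 : ∫⁻ x, ρ ‖x‖ * φ (‖x‖⁻¹ • x) ∂μ =
      ∫⁻ x : ({(0 : E)}ᶜ : Set E), ρ ‖x.1‖ * φ (‖x.1‖⁻¹ • x.1) ∂(μ.comap (↑)) := by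
    rw [lintegral_subtype_comap (measurableSet_singleton _).compl
      (fun x : E ↦ ρ ‖x‖ * φ (‖x‖⁻¹ • x)), restrict_compl_singleton]
  have h2 := μ.measurePreserving_homeomorphUnitSphereProd.lintegral_comp
    (f := fun p ↦ φ p.1.1 * ρ p.2.1) (by fun_prop)
  rw [h1, ← lintegral_prod_mul (by fun_prop) (by fun_prop), ← h2]
  refine lintegral_congr fun x ↦ ?_
  simp [mul_comm]

lemma integral_sq_dual_stdGaussian (L : StrongDual ℝ E) :
    ∫ x, L x ^ 2 ∂stdGaussian E = ‖L‖ ^ 2 := by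
  rw [← variance_dual_stdGaussian, variance_of_integral_eq_zero (by fun_prop)
    (integral_strongDual_stdGaussian L)]

lemma lintegral_sq_norm_stdGaussian :
    ∫⁻ x, ENNReal.ofReal (‖x‖ ^ 2) ∂stdGaussian E = finrank ℝ E := by
  let b := stdOrthonormalBasis ℝ E
  have hint (v : E) : Integrable (fun x ↦ ⟪v, x⟫ ^ 2) (stdGaussian E) :=
    (IsGaussian.memLp_dual (stdGaussian E) (innerSL ℝ v) 2 (by simp)).integrable_sq
  have hsum (x : E) : ‖x‖ ^ 2 = ∑ i, ⟪b i, x⟫ ^ 2 := (b.sum_sq_inner_right x).symm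
  simp_rw [hsum]
  rw [← ofReal_integral_eq_lintegral_ofReal (integrable_finsetSum _ fun i _ ↦ hint _)
    (.of_forall fun x ↦ Finset.sum_nonneg fun i _ ↦ sq_nonneg _),
    integral_finsetSum _ fun i _ ↦ hint _]
  have h1 (i) : ∫ x, ⟪b i, x⟫ ^ 2 ∂stdGaussian E = 1 := by
    have := integral_sq_dual_stdGaussian (innerSL ℝ (b i))
    simpa using this
  simp [h1]


lemma lintegral_sphereUniform {d : ℕ} {φ : EuclideanSpace ℝ (Fin d) → ℝ≥0∞} (hφ : Measurable φ) :
    ∫⁻ u, φ u ∂sphereUniform d =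
      (volume (Metric.closedBall (0 : EuclideanSpace ℝ (Fin d)) 1))⁻¹ *
        ∫⁻ x, (Set.Iic (1 : ℝ)).indicator 1 ‖x‖ * φ (‖x‖⁻¹ • x) := by
  rw [sphereUniform, lintegral_map hφ (by fun_prop), ballUniform, lintegral_smul_measure,
    ← lintegral_indicator Metric.isClosed_closedBall.measurableSet, smul_eq_mul]
  congr 1
  refine lintegral_congr fun x ↦ ?_
  by_cases hx : ‖x‖ ≤ 1 <;> simp [Set.indicator, hx]

lemma volume_closedBall_inv_mul_cancel (d : ℕ) :
    (volume (Metric.closedBall (0 : EuclideanSpace ℝ (Fin d)) 1))⁻¹ *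
      volume (Metric.closedBall (0 : EuclideanSpace ℝ (Fin d)) 1) = 1 :=
  ENNReal.inv_mul_cancel (Metric.measure_closedBall_pos _ _ one_pos).ne'
    (isCompact_closedBall _ _).measure_lt_top.ne

instance isProbabilityMeasure_sphereUniform (d : ℕ) : IsProbabilityMeasure (sphereUniform d) := by
  have : IsProbabilityMeasure (ballUniform d) :=
    ⟨by simpa [ballUniform] using volume_closedBall_inv_mul_cancel d⟩
  exact Measure.isProbabilityMeasure_map (by fun_prop)

/-- The direction of a standard Gaussian vector, weighted by its squared norm, is uniform on the
sphere. -/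
lemma lintegral_sq_norm_mul_angular_stdGaussian {d : ℕ} (hd : 1 ≤ d)
    {φ : EuclideanSpace ℝ (Fin d) → ℝ≥0∞} (hφ : Measurable φ) :
    ∫⁻ x, ENNReal.ofReal (‖x‖ ^ 2) * φ (‖x‖⁻¹ • x) ∂stdGaussian (EuclideanSpace ℝ (Fin d)) =
      d * ∫⁻ u, φ u ∂sphereUniform d := by
  have : NeZero d := ⟨by omega⟩
  have : Nontrivial (EuclideanSpace ℝ (Fin d)) :=
    Module.nontrivial_of_finrank_pos (R := ℝ) (by simp; omega)
  let w : ℝ → ℝ≥0∞ := fun r ↦ ENNReal.ofReal (((2 * Real.pi) ^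
    (finrank ℝ (EuclideanSpace ℝ (Fin d)) / 2 : ℝ))⁻¹ * Real.exp (-(1 / 2) * r ^ 2)) *
      ENNReal.ofReal (r ^ 2)
  have hw : Measurable w := by fun_prop
  have hg (ψ : EuclideanSpace ℝ (Fin d) → ℝ≥0∞) (hψ : Measurable ψ) :
      ∫⁻ x, ENNReal.ofReal (‖x‖ ^ 2) * ψ (‖x‖⁻¹ • x) ∂stdGaussian (EuclideanSpace ℝ (Fin d)) =
        ∫⁻ x, w ‖x‖ * ψ (‖x‖⁻¹ • x) := by
    rw [stdGaussian_eq_withDensity, lintegral_withDensity_eq_lintegral_mul _ (by fun_prop)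
      (by fun_prop)]
    simp [w, mul_assoc]
  have hd1 : (d : ℝ≥0∞) = ∫⁻ x : EuclideanSpace ℝ (Fin d), w ‖x‖ * 1 := by
    rw [← hg _ measurable_const]
    simp only [mul_one, lintegral_sq_norm_stdGaussian, finrank_euclideanSpace_fin]
  have hi : Measurable ((Set.Iic (1 : ℝ)).indicator (1 : ℝ → ℝ≥0∞)) :=
    measurable_one.indicator measurableSet_Iic
  have hball : volume (Metric.closedBall (0 : EuclideanSpace ℝ (Fin d)) 1) =
      ∫⁻ x : EuclideanSpace ℝ (Fin d), (Set.Iic (1 : ℝ)).indicator 1 ‖x‖ * 1 := by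
    rw [← lintegral_indicator_one Metric.isClosed_closedBall.measurableSet]
    refine lintegral_congr fun x ↦ ?_
    by_cases hx : ‖x‖ ≤ 1 <;> simp [Set.indicator, hx]
  have hcancel := volume_closedBall_inv_mul_cancel d
  rw [hg φ hφ, lintegral_sphereUniform hφ, hd1, lintegral_radial_mul_angular _ hw hφ,
    lintegral_radial_mul_angular _ hi hφ, lintegral_radial_mul_angular _ hw measurable_const]
  nth_rw 2 [hball] at hcancel
  rw [lintegral_radial_mul_angular _ hi measurable_const] at hcancel
  set S := ∫⁻ u, φ u.1 ∂(volume : Measure (EuclideanSpace ℝ (Fin d))).toSphere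
  set T := ∫⁻ _, 1 ∂(volume : Measure (EuclideanSpace ℝ (Fin d))).toSphere
  calc _ = S * _ * 1 := (mul_one _).symm
    _ = _ := by rw [← hcancel]; ring

omit [FiniteDimensional ℝ E] [MeasurableSpace E] [BorelSpace E] in
lemma rotation_rotation (a b : ℝ) (z : E × E) :
    ContinuousLinearMap.rotation a (ContinuousLinearMap.rotation b z) =
      ContinuousLinearMap.rotation (a + b) z := by
  ext1 <;> simp only [ContinuousLinearMap.rotation_apply, Real.cos_add, Real.sin_add] <;> module

lemma ae_differentiableAt_stdGaussian {H : E → ℝ} {K : NNReal} (hH : LipschitzWith K H) :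
    ∀ᵐ x ∂stdGaussian E, DifferentiableAt ℝ H x := by
  rw [stdGaussian_eq_withDensity]
  exact (withDensity_absolutelyContinuous _ _).ae_le hH.ae_differentiableAt

omit [FiniteDimensional ℝ E] [MeasurableSpace E] [BorelSpace E] in
/-- Rotating by an angle `t` moves the value of a Lipschitz function by `O(t)`. -/
lemma abs_comp_rotation_sub_le {H : E → ℝ} {K : NNReal} (hH : LipschitzWith K H) (t : ℝ)
    (z : E × E) :
    |H (ContinuousLinearMap.rotation t z).1 - H z.1| ≤ K * |t| * (‖z.1‖ + ‖z.2‖) := by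
  have h1 : (ContinuousLinearMap.rotation t z).1 - z.1 =
      (Real.cos t - Real.cos 0) • z.1 + Real.sin t • z.2 := by
    simp only [ContinuousLinearMap.rotation_apply, Real.cos_zero]; module
  calc |H (ContinuousLinearMap.rotation t z).1 - H z.1|
      ≤ K * ‖(ContinuousLinearMap.rotation t z).1 - z.1‖ := by
        simpa [Real.dist_eq, dist_eq_norm] using hH.dist_le_mul _ _
    _ ≤ K * (|t| * ‖z.1‖ + |t| * ‖z.2‖) := by
        rw [h1]
        gcongr
        refine (norm_add_le _ _).trans ?_
        have hcos : |Real.cos t - Real.cos 0| ≤ |t| := by simpa using Real.abs_cos_sub_cos_le t 0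
        have hsin : |Real.sin t| ≤ |t| := Real.abs_sin_le_abs
        rw [norm_smul, norm_smul, Real.norm_eq_abs, Real.norm_eq_abs]
        exact add_le_add (mul_le_mul_of_nonneg_right hcos (norm_nonneg _))
          (mul_le_mul_of_nonneg_right hsin (norm_nonneg _))
    _ = _ := by ring

omit [FiniteDimensional ℝ E] [MeasurableSpace E] [BorelSpace E] in
/-- The normalized increments of `H` along a rotation converge to the directional derivative. -/
lemma tendsto_comp_rotation_sub {H : E → ℝ} {z : E × E} (hz : DifferentiableAt ℝ H z.1) (a : ℝ) :
    Filter.Tendsto (fun N : ℕ ↦ N * (H (ContinuousLinearMap.rotation (a / N) z).1 - H z.1))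
      Filter.atTop (nhds (a * fderiv ℝ H z.1 z.2)) := by
  have hc : HasDerivAt (fun t : ℝ ↦ (ContinuousLinearMap.rotation t z).1) z.2 0 := by
    simp only [ContinuousLinearMap.rotation_apply]
    simpa [Pi.add_def] using ((Real.hasDerivAt_cos 0).smul_const z.1).add
      ((Real.hasDerivAt_sin 0).smul_const z.2)
  have h0 : (ContinuousLinearMap.rotation 0 z).1 = z.1 := by
    simp [ContinuousLinearMap.rotation_apply]
  have hd : HasDerivAt (fun t : ℝ ↦ H (ContinuousLinearMap.rotation t z).1)
      (fderiv ℝ H z.1 z.2) 0 := by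
    refine HasFDerivAt.comp_hasDerivAt (0 : ℝ) ?_ hc
    rw [h0]
    exact hz.hasFDerivAt
  have h := (hd.hasFDerivAt.lim_real a).comp (tendsto_natCast_atTop_atTop (R := ℝ))
  simpa [Function.comp_def, h0, div_eq_inv_mul] using h

lemma integrable_sq_of_le {f : E × E → ℝ} (hf : Continuous f) {C : ℝ}
    (h : ∀ z, |f z| ≤ C * (‖z.1‖ + ‖z.2‖)) :
    Integrable (fun z ↦ f z ^ 2) ((stdGaussian E).prod (stdGaussian E)) := by
  have h1 : MemLp (fun z : E × E ↦ ‖z.1‖ + ‖z.2‖) 2 ((stdGaussian E).prod (stdGaussian E)) :=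
    ((IsGaussian.memLp_two_id (μ := stdGaussian E)).comp_fst _).norm.add
      ((IsGaussian.memLp_two_id (μ := stdGaussian E)).comp_snd _).norm
  refine (MemLp.of_le (h1.const_mul C) hf.aestronglyMeasurable (.of_forall fun z ↦ ?_)).integrable_sq
  exact (h z).trans (le_abs_self _)

/-- The second moment of the increment of `H` along the half turn is at most `N ^ 2` times the
second moment along its `N`-th part. -/
lemma integral_sq_odd_le {H : E → ℝ} {K : NNReal} (hH : LipschitzWith K H)
    (hodd : ∀ x, H (-x) = -H x) {N : ℕ} (hN : N ≠ 0) :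
    4 * ∫ x, H x ^ 2 ∂stdGaussian E ≤
      ∫ z, (N * (H (ContinuousLinearMap.rotation (Real.pi / N) z).1 - H z.1)) ^ 2
        ∂((stdGaussian E).prod (stdGaussian E)) := by
  set P := (stdGaussian E).prod (stdGaussian E)
  let R (t : ℝ) : E × E →L[ℝ] E × E := ContinuousLinearMap.rotation t
  have hR (t : ℝ) : MeasurePreserving (R t) P P :=
    ⟨by fun_prop, IsGaussian.map_rotation_eq_self (by simp) t⟩
  have hHc := hH.continuous
  let c : E × E → ℝ := fun z ↦ H (R (Real.pi / N) z).1 - H z.1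
  have hcc : Continuous c := by fun_prop
  have hci : Integrable (fun z ↦ c z ^ 2) P :=
    integrable_sq_of_le hcc (abs_comp_rotation_sub_le hH _)
  have hck (k : ℕ) : Integrable (fun z ↦ c (R (k * (Real.pi / N)) z) ^ 2) P :=
    (hR _).integrable_comp_of_integrable hci
  have hN' : (N : ℝ) ≠ 0 := by exact_mod_cast hN
  have hpt (z : E × E) : 4 * H z.1 ^ 2 ≤
      N * ∑ k ∈ Finset.range N, c (R (k * (Real.pi / N)) z) ^ 2 := by
    have hs : ∑ k ∈ Finset.range N, c (R (k * (Real.pi / N)) z) = -2 * H z.1 := by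
      have : ∀ k ∈ Finset.range N, c (R (k * (Real.pi / N)) z) =
          H (R ((k + 1 : ℕ) * (Real.pi / N)) z).1 - H (R (k * (Real.pi / N)) z).1 := by
        intro k _
        simp only [c, R, rotation_rotation]
        congr 4
        push_cast
        ring_nf
      rw [Finset.sum_congr rfl this,
        Finset.sum_range_sub (fun k : ℕ ↦ H (R (k * (Real.pi / N)) z).1), mul_div_cancel₀ _ hN']
      simp [R, ContinuousLinearMap.rotation_apply, hodd]
      ring
    have := sq_sum_le_card_mul_sum_sq (s := Finset.range N)
      (f := fun k : ℕ ↦ c (R (k * (Real.pi / N)) z))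
    rw [hs, Finset.card_range] at this
    linarith
  have hint (k : ℕ) : ∫ z, c (R (k * (Real.pi / N)) z) ^ 2 ∂P = ∫ z, c z ^ 2 ∂P := by
    conv_rhs => rw [← (hR (k * (Real.pi / N))).map_eq]
    rw [integral_map (by fun_prop) (by fun_prop)]
  calc 4 * ∫ x, H x ^ 2 ∂stdGaussian E = ∫ z, 4 * H z.1 ^ 2 ∂P := by
        rw [integral_const_mul, integral_fun_fst (fun x ↦ H x ^ 2)]
        simp
    _ ≤ ∫ z, N * ∑ k ∈ Finset.range N, c (R (k * (Real.pi / N)) z) ^ 2 ∂P :=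
        integral_mono_of_nonneg (.of_forall fun z ↦ by positivity)
          ((integrable_finsetSum _ fun k _ ↦ hck k).const_mul _) (.of_forall hpt)
    _ = _ := by
        rw [integral_const_mul, integral_finsetSum _ fun k _ ↦ hck k]
        simp_rw [hint, mul_pow, integral_const_mul]
        simp [c, R]
        ring

/-- A Poincaré inequality for odd Lipschitz functions of a standard Gaussian vector. -/
lemma integral_sq_le_of_odd_lipschitz {H : E → ℝ} {K : NNReal} (hH : LipschitzWith K H)
    (hodd : ∀ x, H (-x) = -H x) :
    4 * ∫ x, H x ^ 2 ∂stdGaussian E ≤ Real.pi ^ 2 * K ^ 2 := by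
  set P := (stdGaussian E).prod (stdGaussian E)
  have hHc := hH.continuous
  have hae : ∀ᵐ z ∂P, DifferentiableAt ℝ H z.1 :=
    Measure.quasiMeasurePreserving_fst.ae (ae_differentiableAt_stdGaussian hH)
  have hfd (x : E) : ‖fderiv ℝ H x‖ ≤ K := norm_fderiv_le_of_lipschitz ℝ hH
  have hg : Integrable (fun z : E × E ↦ (Real.pi * K * (‖z.1‖ + ‖z.2‖)) ^ 2) P := by
    refine integrable_sq_of_le (C := Real.pi * K) (by fun_prop) fun z ↦ ?_
    rw [abs_of_nonneg (by positivity)]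
  have hlim : Filter.Tendsto (fun N : ℕ ↦
      ∫ z, (N * (H (ContinuousLinearMap.rotation (Real.pi / N) z).1 - H z.1)) ^ 2 ∂P)
      Filter.atTop (nhds (∫ z, (Real.pi * fderiv ℝ H z.1 z.2) ^ 2 ∂P)) := by
    refine tendsto_integral_of_dominated_convergence
      (fun z ↦ (Real.pi * K * (‖z.1‖ + ‖z.2‖)) ^ 2) (fun N ↦ ?_) hg (fun N ↦ ?_) ?_
    · exact Continuous.aestronglyMeasurable (by fun_prop)
    · refine .of_forall fun z ↦ ?_
      rw [Real.norm_eq_abs, abs_pow, abs_mul, Nat.abs_cast]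
      have h1 := abs_comp_rotation_sub_le hH (Real.pi / N) z
      refine pow_le_pow_left₀ (by positivity) ?_ 2
      rcases eq_or_ne N 0 with rfl | hN
      · simp; positivity
      have hN' : (0 : ℝ) < N := by positivity
      calc N * |H (ContinuousLinearMap.rotation (Real.pi / N) z).1 - H z.1|
          ≤ N * (K * |Real.pi / N| * (‖z.1‖ + ‖z.2‖)) := by gcongr
        _ = _ := by
          rw [abs_of_nonneg (div_nonneg Real.pi_pos.le hN'.le)]
          field_simp
    · filter_upwards [hae] with z hz
      exact (tendsto_comp_rotation_sub hz _).pow 2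
  have hle : 4 * ∫ x, H x ^ 2 ∂stdGaussian E ≤ ∫ z, (Real.pi * fderiv ℝ H z.1 z.2) ^ 2 ∂P :=
    ge_of_tendsto hlim ((Filter.eventually_ne_atTop 0).mono fun N hN ↦
      integral_sq_odd_le hH hodd hN)
  have hmeas : Measurable fun z : E × E ↦ (Real.pi * fderiv ℝ H z.1 z.2) ^ 2 := by
    have : Measurable fun z : E × E ↦ fderiv ℝ H z.1 z.2 :=
      (ContinuousLinearMap.measurable_apply₂ (𝕜 := ℝ) (E := E) (F := ℝ)).comp
        (((measurable_fderiv ℝ H).comp measurable_fst).prodMk measurable_snd)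
    fun_prop
  have hint : Integrable (fun z : E × E ↦ (Real.pi * fderiv ℝ H z.1 z.2) ^ 2) P := by
    refine hg.mono' hmeas.aestronglyMeasurable (.of_forall fun z ↦ ?_)
    rw [Real.norm_eq_abs, abs_pow, abs_mul, abs_of_pos Real.pi_pos, mul_assoc]
    gcongr
    calc |fderiv ℝ H z.1 z.2| ≤ ‖fderiv ℝ H z.1‖ * ‖z.2‖ := (fderiv ℝ H z.1).le_opNorm _
      _ ≤ K * (‖z.1‖ + ‖z.2‖) := by
        gcongr
        · exact hfd _
        · simp
  refine hle.trans ?_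
  rw [integral_prod _ hint]
  simp_rw [mul_pow, integral_const_mul, integral_sq_dual_stdGaussian]
  gcongr
  calc ∫ x, ‖fderiv ℝ H x‖ ^ 2 ∂stdGaussian E ≤ ∫ x, (K : ℝ) ^ 2 ∂stdGaussian E :=
        integral_mono_of_nonneg (.of_forall fun x ↦ by positivity) (integrable_const _)
          (.of_forall fun x ↦ by have := hfd x; dsimp only; gcongr)
    _ = _ := by simp

omit [FiniteDimensional ℝ E] [MeasurableSpace E] [BorelSpace E] in
/-- The positively homogeneous extension of the restriction of a Lipschitz function to the unit
sphere is Lipschitz. -/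
lemma lipschitzWith_norm_mul_comp_normalize {h : E → ℝ} {K : NNReal} (hh : LipschitzWith K h)
    (h0 : h 0 = 0) : LipschitzWith (3 * K) (fun x ↦ ‖x‖ * h (‖x‖⁻¹ • x)) := by
  have hb (x : E) : |h (‖x‖⁻¹ • x)| ≤ K := by
    have h1 : |h (‖x‖⁻¹ • x)| ≤ K * ‖‖x‖⁻¹ • x‖ := by simpa [h0] using hh.dist_le_mul (‖x‖⁻¹ • x) 0
    refine h1.trans (mul_le_of_le_one_right K.2 ?_)
    rw [norm_smul, norm_inv, norm_norm]
    exact inv_mul_le_one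
  refine LipschitzWith.of_dist_le_mul fun x y ↦ ?_
  rw [Real.dist_eq, dist_eq_norm]
  push_cast
  have hxy := abs_norm_sub_norm_le x y
  have hang : ‖y‖ * ‖‖x‖⁻¹ • x - ‖y‖⁻¹ • y‖ ≤ 2 * ‖x - y‖ := by
    rcases eq_or_ne x 0 with rfl | hx
    · rcases eq_or_ne y 0 with rfl | hy
      · simp
      · rw [norm_zero, inv_zero, zero_smul, zero_sub, zero_sub, norm_neg, norm_neg, norm_smul,
          norm_inv, norm_norm, inv_mul_cancel₀ (norm_ne_zero_iff.2 hy)]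
        linarith [norm_nonneg y]
    rcases eq_or_ne y 0 with rfl | hy
    · simp
    have hx' := norm_ne_zero_iff.2 hx
    have hy' := norm_ne_zero_iff.2 hy
    have heq : ‖y‖ • (‖x‖⁻¹ • x - ‖y‖⁻¹ • y) = ((‖y‖ - ‖x‖) * ‖x‖⁻¹) • x + (x - y) := by
      rw [smul_sub, smul_smul, smul_smul, sub_mul, mul_inv_cancel₀ hx', mul_inv_cancel₀ hy']
      module
    calc ‖y‖ * ‖‖x‖⁻¹ • x - ‖y‖⁻¹ • y‖ = ‖‖y‖ • (‖x‖⁻¹ • x - ‖y‖⁻¹ • y)‖ := by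
          rw [norm_smul, norm_norm]
      _ ≤ ‖((‖y‖ - ‖x‖) * ‖x‖⁻¹) • x‖ + ‖x - y‖ := heq ▸ norm_add_le _ _
      _ = |‖x‖ - ‖y‖| + ‖x - y‖ := by
          rw [norm_smul, norm_mul, norm_inv, norm_norm, mul_assoc, inv_mul_cancel₀ hx', mul_one,
            Real.norm_eq_abs, abs_sub_comm]
      _ ≤ 2 * ‖x - y‖ := by linarith
  have hd : |h (‖x‖⁻¹ • x) - h (‖y‖⁻¹ • y)| ≤ K * ‖‖x‖⁻¹ • x - ‖y‖⁻¹ • y‖ := by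
    simpa [Real.dist_eq, dist_eq_norm] using hh.dist_le_mul (‖x‖⁻¹ • x) (‖y‖⁻¹ • y)
  calc |‖x‖ * h (‖x‖⁻¹ • x) - ‖y‖ * h (‖y‖⁻¹ • y)|
      = |(‖x‖ - ‖y‖) * h (‖x‖⁻¹ • x) + ‖y‖ * (h (‖x‖⁻¹ • x) - h (‖y‖⁻¹ • y))| := by ring_nf
    _ ≤ |‖x‖ - ‖y‖| * |h (‖x‖⁻¹ • x)| + ‖y‖ * |h (‖x‖⁻¹ • x) - h (‖y‖⁻¹ • y)| := by
        refine (abs_add_le _ _).trans_eq ?_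
        rw [abs_mul, abs_mul, abs_norm]
    _ ≤ ‖x - y‖ * K + ‖y‖ * (K * ‖‖x‖⁻¹ • x - ‖y‖⁻¹ • y‖) := by
        gcongr
        exact hb x
    _ = ‖x - y‖ * K + K * (‖y‖ * ‖‖x‖⁻¹ • x - ‖y‖⁻¹ • y‖) := by ring
    _ ≤ ‖x - y‖ * K + K * (2 * ‖x - y‖) := by gcongr
    _ = 3 * K * ‖x - y‖ := by ring

/-- An odd `K`-Lipschitz function on the sphere of `ℝ^d` has second moment `O(K² / d)`. -/
lemma mul_integral_sq_sphereUniform_le {d : ℕ} (hd : 1 ≤ d) {h : EuclideanSpace ℝ (Fin d) → ℝ}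
    {K : NNReal} (hh : LipschitzWith K h) (hodd : ∀ x, h (-x) = -h x) :
    4 * (d * ∫ u, h u ^ 2 ∂sphereUniform d) ≤ 9 * Real.pi ^ 2 * K ^ 2 := by
  have h0 : h 0 = 0 := by have := hodd 0; simp only [neg_zero] at this; linarith
  have hc := hh.continuous
  have hP := integral_sq_le_of_odd_lipschitz (lipschitzWith_norm_mul_comp_normalize hh h0)
    (fun x ↦ by simp [hodd])
  have hE : ∫ x, (‖x‖ * h (‖x‖⁻¹ • x)) ^ 2 ∂stdGaussian (EuclideanSpace ℝ (Fin d)) =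
      d * ∫ u, h u ^ 2 ∂sphereUniform d := by
    have hm : Measurable h := hc.measurable
    rw [integral_eq_lintegral_of_nonneg_ae (.of_forall fun x ↦ sq_nonneg _)
      (Measurable.aestronglyMeasurable (by fun_prop)),
      integral_eq_lintegral_of_nonneg_ae (.of_forall fun x ↦ sq_nonneg _)
      (Measurable.aestronglyMeasurable (by fun_prop))]
    simp_rw [mul_pow, ENNReal.ofReal_mul (sq_nonneg ‖_‖)]
    rw [lintegral_sq_norm_mul_angular_stdGaussian (φ := fun u ↦ ENNReal.ofReal (h u ^ 2)) hd
      (by fun_prop), ENNReal.toReal_mul, ENNReal.toReal_natCast]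
  rw [hE] at hP
  push_cast at hP
  linarith

lemma ae_norm_le_one_sphereUniform (d : ℕ) : ∀ᵐ u ∂sphereUniform d, ‖u‖ ≤ 1 := by
  rw [sphereUniform, ae_map_iff (by fun_prop) (measurableSet_le (by fun_prop) (by fun_prop))]
  refine .of_forall fun x ↦ ?_
  rw [norm_smul, norm_inv, norm_norm]
  exact inv_mul_le_one

end

/-- Second-moment bound for the (per-step) LAZOb gradient estimator (Lemma 4, part (b)):
`E_u[‖g(u)‖²] ≤ D²η²d²L²/δ² + c d L²`. -/
theorem stmt8 :
    ∃ c : ℝ, 0 < c ∧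
      ∀ (d : ℕ), 1 ≤ d → ∀ δ η D L : ℝ, 0 < δ → 0 < η → 0 < D → 0 ≤ L →
      ∀ ft ftm : EuclideanSpace ℝ (Fin d) → ℝ,
        (∀ x y, |ft x - ft y| ≤ L * ‖x - y‖) → (∀ x y, |ftm x - ftm y| ≤ L * ‖x - y‖) →
      ∀ xt xtm utm : EuclideanSpace ℝ (Fin d), ‖utm‖ = 1 →
        (∫ u, ‖(if |ft (xt + δ • u) - ftm (xtm + δ • utm)| ≤ D * η * L then
                ((d : ℝ) / δ * (ft (xt + δ • u) - ftm (xtm + δ • utm))) • u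
              else
                ((d : ℝ) / (2 * δ) * (ft (xt + δ • u) - ft (xt - δ • u))) • u)‖ ^ 2
          ∂(sphereUniform d)) ≤
          D ^ 2 * η ^ 2 * (d : ℝ) ^ 2 * L ^ 2 / δ ^ 2 + c * d * L ^ 2 := by
  refine ⟨9 * Real.pi ^ 2 / 4, by positivity, ?_⟩
  intro d hd δ η D L hδ hη hD hL ft ftm hft _ xt xtm utm _
  set h : EuclideanSpace ℝ (Fin d) → ℝ := fun u ↦ ft (xt + δ • u) - ft (xt - δ • u) with hdef
  let K : NNReal := ⟨2 * L * δ, by positivity⟩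
  have hlip : LipschitzWith K h := by
    refine LipschitzWith.of_dist_le_mul fun u v ↦ ?_
    have h1 := hft (xt + δ • u) (xt + δ • v)
    have h2 := hft (xt - δ • v) (xt - δ • u)
    rw [add_sub_add_left_eq_sub, ← smul_sub, norm_smul, Real.norm_of_nonneg hδ.le] at h1
    rw [sub_sub_sub_cancel_left, ← smul_sub, norm_smul, Real.norm_of_nonneg hδ.le] at h2
    calc dist (h u) (h v) = |(ft (xt + δ • u) - ft (xt + δ • v)) +
          (ft (xt - δ • v) - ft (xt - δ • u))| := by rw [Real.dist_eq]; simp only [hdef]; ring_nf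
      _ ≤ L * (δ * ‖u - v‖) + L * (δ * ‖u - v‖) := (abs_add_le _ _).trans (add_le_add h1 h2)
      _ = K * dist u v := by rw [dist_eq_norm]; change _ = 2 * L * δ * _; ring
  have hodd (x) : h (-x) = -h x := by simp [hdef, sub_eq_add_neg]
  have hmom := mul_integral_sq_sphereUniform_le hd hlip hodd
  have hK : (K : ℝ) = 2 * L * δ := rfl
  have hint : Integrable (fun u ↦ h u ^ 2) (sphereUniform d) := by
    refine Integrable.of_bound (hlip.continuous.pow 2).aestronglyMeasurable ((K : ℝ) ^ 2) ?_
    filter_upwards [ae_norm_le_one_sphereUniform d] with u hu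
    have h0 : h 0 = 0 := by simp [hdef]
    have h1 : |h u| ≤ K * ‖u‖ := by simpa [h0] using hlip.dist_le_mul u 0
    rw [norm_pow, Real.norm_eq_abs]
    exact pow_le_pow_left₀ (abs_nonneg _) (h1.trans (mul_le_of_le_one_right K.2 hu)) 2
  have hpt : ∀ᵐ u ∂sphereUniform d,
      ‖(if |ft (xt + δ • u) - ftm (xtm + δ • utm)| ≤ D * η * L then
          ((d : ℝ) / δ * (ft (xt + δ • u) - ftm (xtm + δ • utm))) • u
        else ((d : ℝ) / (2 * δ) * (ft (xt + δ • u) - ft (xt - δ • u))) • u)‖ ^ 2 ≤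
        ((d : ℝ) / δ * (D * η * L)) ^ 2 + ((d : ℝ) / (2 * δ)) ^ 2 * h u ^ 2 := by
    filter_upwards [ae_norm_le_one_sphereUniform d] with u hu
    have hsq (a : ℝ) : ‖a • u‖ ^ 2 ≤ |a| ^ 2 := by
      rw [norm_smul, Real.norm_eq_abs]
      exact pow_le_pow_left₀ (by positivity) (mul_le_of_le_one_right (abs_nonneg _) hu) 2
    split_ifs with hA
    · refine (hsq _).trans (le_add_of_le_of_nonneg ?_ (by positivity))
      rw [abs_mul, abs_of_nonneg (by positivity : (0 : ℝ) ≤ d / δ)]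
      gcongr
    · refine (hsq _).trans (le_add_of_nonneg_of_le (by positivity) ?_)
      rw [sq_abs, mul_pow]
  refine (integral_mono_of_nonneg (.of_forall fun u ↦ by positivity)
    ((integrable_const _).add (hint.const_mul _)) hpt).trans ?_
  rw [integral_add' (integrable_const _) (hint.const_mul _), integral_const, integral_const_mul]
  simp only [probReal_univ, one_smul]
  have hd' : (0 : ℝ) < d := by exact_mod_cast hd
  refine add_le_add (le_of_eq (by field_simp)) ?_
  rw [hK] at hmom
  calc ((d : ℝ) / (2 * δ)) ^ 2 * ∫ u, h u ^ 2 ∂sphereUniform d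
      = d / (16 * δ ^ 2) * (4 * (d * ∫ u, h u ^ 2 ∂sphereUniform d)) := by field_simp; ring
    _ ≤ d / (16 * δ ^ 2) * (9 * Real.pi ^ 2 * (2 * L * δ) ^ 2) := by gcongr
    _ = 9 * Real.pi ^ 2 / 4 * d * L ^ 2 := by field_simp; ring
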